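/- For any four random variables X1, X2, X3, X4 and every integer s ≥ 1, the first Matúš family inequality holds: s·[I(X1:X2|X3) + I(X1:X2|X4) + I(X3:X4) − I(X1:X2)] + I(X1:X3|X2) + (s(s+1)/2)·[I(X2:X3|X1) + I(X1:X2|X3)] ≥ 0. -/

import Mathlib

open Finset
open scoped Classical

/-- Probability that the random variable `X` (on the finite weighted sample space
`(Ω, μ)`) takes the value `b`. -/
noncomputable def pr {Ω β : Type*} [Fintype Ω] (μ : Ω → ℝ) (X : Ω → β) (b : β) : ℝ :=
  ∑ ω, if X ω = b then μ ω else 0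

/-- Shannon entropy of the random variable `X` on the finite weighted sample space
`(Ω, μ)`. -/
noncomputable def ent {Ω β : Type*} [Fintype Ω] [Fintype β] (μ : Ω → ℝ) (X : Ω → β) : ℝ :=
  ∑ b, Real.negMulLog (pr μ X b)

/-- Mutual information `I(X : Y)`. -/
noncomputable def mi {Ω β γ : Type*} [Fintype Ω] [Fintype β] [Fintype γ]
    (μ : Ω → ℝ) (X : Ω → β) (Y : Ω → γ) : ℝ :=
  ent μ X + ent μ Y - ent μ (fun ω => (X ω, Y ω))

/-- Conditional mutual information `I(X : Y | Z)`. -/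
noncomputable def cmi {Ω β γ δ : Type*} [Fintype Ω] [Fintype β] [Fintype γ] [Fintype δ]
    (μ : Ω → ℝ) (X : Ω → β) (Y : Ω → γ) (Z : Ω → δ) : ℝ :=
  ent μ (fun ω => (X ω, Z ω)) + ent μ (fun ω => (Y ω, Z ω)) - ent μ Z
    - ent μ (fun ω => (X ω, Y ω, Z ω))

/-- The Ingleton quantity `I_ING(S,T;U,V)`. -/
noncomputable def ing {Ω β γ δ ε : Type*} [Fintype Ω] [Fintype β] [Fintype γ] [Fintype δ]
    [Fintype ε] (μ : Ω → ℝ) (S : Ω → β) (T : Ω → γ) (U : Ω → δ) (V : Ω → ε) : ℝ :=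
  cmi μ S T U + cmi μ S T V + mi μ U V - mi μ S T

theorem pr_nonneg {Ω β : Type*} [Fintype Ω] {μ : Ω → ℝ} (hμ : ∀ ω, 0 ≤ μ ω) (X : Ω → β)
    (b : β) : 0 ≤ pr μ X b :=
  Finset.sum_nonneg fun ω _ => by split_ifs <;> simp [hμ]

theorem le_pr_apply {Ω β : Type*} [Fintype Ω] {μ : Ω → ℝ} (hμ : ∀ ω, 0 ≤ μ ω) (X : Ω → β)
    (ω : Ω) : μ ω ≤ pr μ X (X ω) := by
  have h := Finset.single_le_sum (f := fun ω' => if X ω' = X ω then μ ω' else 0)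
    (fun ω' _ => by split_ifs <;> simp [hμ]) (Finset.mem_univ ω)
  simpa [pr] using h

theorem sum_pr_mul {Ω β : Type*} [Fintype Ω] [Fintype β] (μ : Ω → ℝ) (X : Ω → β) (f : β → ℝ) :
    ∑ b, pr μ X b * f b = ∑ ω, μ ω * f (X ω) := by
  simp only [pr, Finset.sum_mul, ite_mul, zero_mul]
  rw [Finset.sum_comm]
  simp

theorem sum_pr {Ω β : Type*} [Fintype Ω] [Fintype β] (μ : Ω → ℝ) (X : Ω → β) :
    ∑ b, pr μ X b = ∑ ω, μ ω := by
  simpa using sum_pr_mul μ X fun _ => 1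

theorem sum_pr_prod {Ω β γ : Type*} [Fintype Ω] [Fintype β] (μ : Ω → ℝ) (X : Ω → β)
    (Z : Ω → γ) (z : γ) : ∑ x, pr μ (fun ω => (X ω, Z ω)) (x, z) = pr μ Z z := by
  simp only [pr, Prod.mk.injEq, ite_and]
  rw [Finset.sum_comm]
  simp

theorem ent_eq_sum {Ω β : Type*} [Fintype Ω] [Fintype β] (μ : Ω → ℝ) (X : Ω → β) :
    ent μ X = -∑ ω, μ ω * Real.log (pr μ X (X ω)) := by
  rw [← sum_pr_mul μ X fun b => Real.log (pr μ X b), ← Finset.sum_neg_distrib]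
  simp [ent, Real.negMulLog]

/-- Conditional mutual information is nonnegative, for every finite nonnegative measure. -/
theorem cmi_nonneg {Ω β γ δ : Type*} [Fintype Ω] [Fintype β] [Fintype γ] [Fintype δ]
    {μ : Ω → ℝ} (hμ : ∀ ω, 0 ≤ μ ω) (X : Ω → β) (Y : Ω → γ) (Z : Ω → δ) :
    0 ≤ cmi μ X Y Z := by
  set P := pr μ fun ω => (X ω, Y ω, Z ω) with hP
  set PX := pr μ fun ω => (X ω, Z ω) with hPX
  set PY := pr μ fun ω => (Y ω, Z ω) with hPY
  set PZ := pr μ Z with hPZ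
  have hcmi : cmi μ X Y Z = ∑ ω, μ ω * (Real.log (P (X ω, Y ω, Z ω)) + Real.log (PZ (Z ω))
      - Real.log (PX (X ω, Z ω)) - Real.log (PY (Y ω, Z ω))) := by
    simp only [cmi, ent_eq_sum, mul_add, mul_sub, Finset.sum_add_distrib, Finset.sum_sub_distrib,
      ← hP, ← hPX, ← hPY, ← hPZ]
    ring
  have hlog : ∀ ω, μ ω * (1 - PX (X ω, Z ω) * PY (Y ω, Z ω) / (P (X ω, Y ω, Z ω) * PZ (Z ω)))
      ≤ μ ω * (Real.log (P (X ω, Y ω, Z ω)) + Real.log (PZ (Z ω))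
        - Real.log (PX (X ω, Z ω)) - Real.log (PY (Y ω, Z ω))) := by
    intro ω
    rcases (hμ ω).eq_or_lt with h0 | hpos
    · simp [← h0]
    have h1 : 0 < P (X ω, Y ω, Z ω) := hpos.trans_le (le_pr_apply hμ (fun ω => (X ω, Y ω, Z ω)) ω)
    have h2 : 0 < PX (X ω, Z ω) := hpos.trans_le (le_pr_apply hμ (fun ω => (X ω, Z ω)) ω)
    have h3 : 0 < PY (Y ω, Z ω) := hpos.trans_le (le_pr_apply hμ (fun ω => (Y ω, Z ω)) ω)
    have h4 : 0 < PZ (Z ω) := hpos.trans_le (le_pr_apply hμ Z ω)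
    refine mul_le_mul_of_nonneg_left ?_ hpos.le
    have h := Real.log_le_sub_one_of_pos (div_pos (mul_pos h2 h3) (mul_pos h1 h4))
    rw [Real.log_div (mul_pos h2 h3).ne' (mul_pos h1 h4).ne', Real.log_mul h2.ne' h3.ne',
      Real.log_mul h1.ne' h4.ne'] at h
    linarith
  have hmass : ∑ ω, μ ω * (PX (X ω, Z ω) * PY (Y ω, Z ω) / (P (X ω, Y ω, Z ω) * PZ (Z ω)))
      ≤ ∑ ω, μ ω := by
    rw [← sum_pr_mul μ (fun ω => (X ω, Y ω, Z ω))
      fun t => PX (t.1, t.2.2) * PY (t.2.1, t.2.2) / (P t * PZ t.2.2)]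
    calc _ ≤ ∑ t : β × γ × δ, PX (t.1, t.2.2) * PY (t.2.1, t.2.2) / PZ t.2.2 := by
          refine Finset.sum_le_sum fun t _ => ?_
          have hq : 0 ≤ PX (t.1, t.2.2) * PY (t.2.1, t.2.2) / PZ t.2.2 :=
            div_nonneg (mul_nonneg (pr_nonneg hμ _ _) (pr_nonneg hμ _ _)) (pr_nonneg hμ _ _)
          rw [← hP]
          by_cases h : P t = 0
          · simpa [h] using hq
          · exact le_of_eq (by rw [← mul_div_assoc, mul_div_mul_left _ _ h])
      _ = ∑ z, PZ z * PZ z / PZ z := by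
          simp only [Fintype.sum_prod_type]
          simp_rw [Finset.sum_comm (s := (Finset.univ : Finset γ)),
            Finset.sum_comm (s := (Finset.univ : Finset β)) (t := (Finset.univ : Finset δ)),
            ← Finset.sum_div, ← Finset.mul_sum, ← Finset.sum_mul]
          simp_rw [hPX, hPY, hPZ, sum_pr_prod]
      _ = ∑ ω, μ ω := by
          simp only [mul_self_div_self]
          exact sum_pr μ Z
  rw [hcmi]
  refine le_trans ?_ (Finset.sum_le_sum fun ω _ => hlog ω)
  simp only [mul_sub, mul_one, Finset.sum_sub_distrib]
  linarith

/-- Entropy of the partition of `Ω` into the classes of `r`. -/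
noncomputable def partitionEnt {Ω : Type*} [Fintype Ω] (μ : Ω → ℝ) (r : Setoid Ω) : ℝ :=
  -∑ ω, μ ω * Real.log (∑ ω', if r ω' ω then μ ω' else 0)

theorem ent_eq_partitionEnt {Ω β : Type*} [Fintype Ω] [Fintype β] (μ : Ω → ℝ) (X : Ω → β) :
    ent μ X = partitionEnt μ (Setoid.ker X) := by
  simp [ent_eq_sum, partitionEnt, pr, Setoid.ker_def]

theorem ker_prodMk {Ω β γ : Type*} (X : Ω → β) (Y : Ω → γ) :
    Setoid.ker (fun ω => (X ω, Y ω)) = Setoid.ker X ⊓ Setoid.ker Y := by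
  ext ω ω'
  simp [Setoid.ker_def, Setoid.inf_iff_and]

/-- Two draws from `μ` which agree in `S` and are conditionally independent given `S`. -/
noncomputable def condProd {Ω σ : Type*} [Fintype Ω] (μ : Ω → ℝ) (S : Ω → σ) (p : Ω × Ω) : ℝ :=
  if S p.1 = S p.2 then μ p.1 * μ p.2 / pr μ S (S p.1) else 0

section condProd

variable {Ω σ : Type*} [Fintype Ω] {μ : Ω → ℝ}

theorem condProd_nonneg (hμ : ∀ ω, 0 ≤ μ ω) (S : Ω → σ) (p : Ω × Ω) : 0 ≤ condProd μ S p := by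
  unfold condProd
  split_ifs
  · exact div_nonneg (mul_nonneg (hμ _) (hμ _)) (pr_nonneg hμ _ _)
  · exact le_rfl

theorem condProd_swap (S : Ω → σ) (ω ω' : Ω) : condProd μ S (ω', ω) = condProd μ S (ω, ω') := by
  by_cases h : S ω = S ω'
  · simp [condProd, h, mul_comm]
  · simp [condProd, h, Ne.symm h]

theorem sum_condProd_right (hμ : ∀ ω, 0 ≤ μ ω) (S : Ω → σ) (ω : Ω) :
    ∑ ω', condProd μ S (ω, ω') = μ ω := by
  have h : ∑ ω', condProd μ S (ω, ω') = μ ω / pr μ S (S ω) * pr μ S (S ω) := by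
    conv_rhs => enter [2]; rw [pr]
    rw [Finset.mul_sum]
    refine Finset.sum_congr rfl fun ω' _ => ?_
    by_cases h : S ω = S ω'
    · simp only [condProd, h, if_true]; ring
    · simp [condProd, h, Ne.symm h]
  rw [h]
  refine div_mul_cancel_of_imp fun h0 => ?_
  exact le_antisymm (h0 ▸ le_pr_apply hμ S ω) (hμ ω)

theorem sum_condProd_mul_fst (hμ : ∀ ω, 0 ≤ μ ω) (S : Ω → σ) (f : Ω → ℝ) :
    ∑ p, condProd μ S p * f p.1 = ∑ ω, μ ω * f ω := by
  simp only [Fintype.sum_prod_type, ← Finset.sum_mul, sum_condProd_right hμ]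

theorem sum_condProd_mul_snd (hμ : ∀ ω, 0 ≤ μ ω) (S : Ω → σ) (f : Ω → ℝ) :
    ∑ p, condProd μ S p * f p.2 = ∑ ω, μ ω * f ω := by
  rw [← sum_condProd_mul_fst hμ S f, Fintype.sum_prod_type_right, Fintype.sum_prod_type]
  simp only [condProd_swap]

variable {β γ : Type*}

theorem pr_condProd_fst (hμ : ∀ ω, 0 ≤ μ ω) (S : Ω → σ) (X : Ω → β) (b : β) :
    pr (condProd μ S) (fun p => X p.1) b = pr μ X b := by
  simpa [pr] using sum_condProd_mul_fst hμ S fun ω => if X ω = b then 1 else 0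

theorem ent_condProd_fst [Fintype β] (hμ : ∀ ω, 0 ≤ μ ω) (S : Ω → σ) (X : Ω → β) :
    ent (condProd μ S) (fun p => X p.1) = ent μ X := by
  simp only [ent, pr_condProd_fst hμ]

theorem cmi_condProd_fst {δ : Type*} [Fintype β] [Fintype γ] [Fintype δ] (hμ : ∀ ω, 0 ≤ μ ω)
    (S : Ω → σ) (X : Ω → β) (Y : Ω → γ) (Z : Ω → δ) :
    cmi (condProd μ S) (fun p => X p.1) (fun p => Y p.1) (fun p => Z p.1) = cmi μ X Y Z := by
  rw [cmi, cmi, ← ent_condProd_fst hμ S fun ω => (X ω, Z ω),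
    ← ent_condProd_fst hμ S fun ω => (Y ω, Z ω), ← ent_condProd_fst hμ S Z,
    ← ent_condProd_fst hμ S fun ω => (X ω, Y ω, Z ω)]

theorem mi_condProd_fst [Fintype β] [Fintype γ] (hμ : ∀ ω, 0 ≤ μ ω)
    (S : Ω → σ) (X : Ω → β) (Y : Ω → γ) :
    mi (condProd μ S) (fun p => X p.1) (fun p => Y p.1) = mi μ X Y := by
  rw [mi, mi, ← ent_condProd_fst hμ S X, ← ent_condProd_fst hμ S Y,
    ← ent_condProd_fst hμ S fun ω => (X ω, Y ω)]

theorem ing_condProd_fst {δ ε : Type*} [Fintype β] [Fintype γ] [Fintype δ] [Fintype ε]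
    (hμ : ∀ ω, 0 ≤ μ ω) (S : Ω → σ) (X : Ω → β) (Y : Ω → γ) (Z : Ω → δ) (W : Ω → ε) :
    ing (condProd μ S) (fun p => X p.1) (fun p => Y p.1) (fun p => Z p.1) (fun p => W p.1) =
      ing μ X Y Z W := by
  simp only [ing, cmi_condProd_fst hμ, mi_condProd_fst hμ]

theorem pr_condProd_snd (hμ : ∀ ω, 0 ≤ μ ω) (S : Ω → σ) (X : Ω → β) {F : Ω × Ω → β}
    (hF : ∀ p : Ω × Ω, S p.1 = S p.2 → F p = X p.2) (b : β) :
    pr (condProd μ S) F b = pr μ X b := by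
  have h := sum_condProd_mul_snd hμ S fun ω => if X ω = b then 1 else 0
  simp only [mul_ite, mul_one, mul_zero] at h
  rw [pr, pr, ← h]
  refine Finset.sum_congr rfl fun p _ => ?_
  by_cases hp : S p.1 = S p.2
  · rw [hF p hp]
  · simp [condProd, hp]

/-- The law of a variable that uses the first draw only through `S` is its law under `μ`. -/
theorem ent_condProd_snd [Fintype β] (hμ : ∀ ω, 0 ≤ μ ω) (S : Ω → σ) (X : Ω → β)
    {F : Ω × Ω → β} (hF : ∀ p : Ω × Ω, S p.1 = S p.2 → F p = X p.2) :
    ent (condProd μ S) F = ent μ X := by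
  simp only [ent, pr_condProd_snd hμ S X hF]

theorem pr_condProd (S : Ω → σ) (X : Ω → β) (Y : Ω → γ) (b : β) (c : γ) (t : σ) :
    pr (condProd μ S) (fun p => (X p.1, Y p.2, S p.1)) (b, c, t) =
      pr μ (fun ω => (X ω, S ω)) (b, t) * pr μ (fun ω => (Y ω, S ω)) (c, t) / pr μ S t := by
  rw [pr, Fintype.sum_prod_type, pr, pr, Finset.sum_mul_sum, Finset.sum_div]
  refine Finset.sum_congr rfl fun ω _ => ?_
  rw [Finset.sum_div]
  refine Finset.sum_congr rfl fun ω' _ => ?_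
  simp only [condProd, Prod.mk.injEq]
  by_cases h1 : X ω = b <;> by_cases h2 : Y ω' = c <;> by_cases h3 : S ω = t <;>
    by_cases h4 : S ω' = t <;> simp [h1, h2, h3, h4, eq_comm]
  intro h
  exact absurd h.symm h4

theorem cmi_condProd [Fintype σ] [Fintype β] [Fintype γ] (hμ : ∀ ω, 0 ≤ μ ω) (S : Ω → σ)
    (X : Ω → β) (Y : Ω → γ) :
    cmi (condProd μ S) (fun p => X p.1) (fun p => Y p.2) (fun p => S p.1) = 0 := by
  have hXS := ent_condProd_fst hμ S fun ω => (X ω, S ω)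
  have hS := ent_condProd_fst hμ S S
  have hYS := ent_condProd_snd hμ S (fun ω => (Y ω, S ω))
    (F := fun p => (Y p.2, S p.1)) fun p hp => by rw [hp]
  have hsplit : ∀ p : Ω × Ω, condProd μ S p *
      Real.log (pr (condProd μ S) (fun p => (X p.1, Y p.2, S p.1)) (X p.1, Y p.2, S p.1)) =
      condProd μ S p * Real.log (pr μ (fun ω => (X ω, S ω)) (X p.1, S p.1)) +
      condProd μ S p * Real.log (pr μ (fun ω => (Y ω, S ω)) (Y p.2, S p.2)) -
      condProd μ S p * Real.log (pr μ S (S p.1)) := by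
    intro p
    by_cases h0 : condProd μ S p = 0
    · simp [h0]
    have hp : S p.1 = S p.2 := by
      by_contra h
      exact h0 (by simp [condProd, h])
    have h1 : 0 < μ p.1 := (hμ _).lt_of_ne' fun h => h0 (by simp [condProd, h])
    have h2 : 0 < μ p.2 := (hμ _).lt_of_ne' fun h => h0 (by simp [condProd, h])
    have hX := h1.trans_le (le_pr_apply hμ (fun ω => (X ω, S ω)) p.1)
    have hY := h2.trans_le (le_pr_apply hμ (fun ω => (Y ω, S ω)) p.2)
    have hS := h1.trans_le (le_pr_apply hμ S p.1)
    rw [pr_condProd, hp, Real.log_div, Real.log_mul]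
    · ring
    · rw [← hp]; exact hX.ne'
    · exact hY.ne'
    · rw [← hp]; exact (mul_pos hX (by rw [hp]; exact hY)).ne'
    · rw [← hp]; exact hS.ne'
  have hjoint : ent (condProd μ S) (fun p => (X p.1, Y p.2, S p.1)) =
      ent μ (fun ω => (X ω, S ω)) + ent μ (fun ω => (Y ω, S ω)) - ent μ S := by
    rw [ent_eq_sum, Finset.sum_congr rfl fun p _ => hsplit p, Finset.sum_sub_distrib,
      Finset.sum_add_distrib,
      sum_condProd_mul_fst hμ S fun ω => Real.log (pr μ (fun ω => (X ω, S ω)) (X ω, S ω)),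
      sum_condProd_mul_snd hμ S fun ω => Real.log (pr μ (fun ω => (Y ω, S ω)) (Y ω, S ω)),
      sum_condProd_mul_fst hμ S fun ω => Real.log (pr μ S (S ω)), ent_eq_sum, ent_eq_sum,
      ent_eq_sum]
    ring
  rw [cmi, hXS, hYS, hS, hjoint]
  ring

end condProd

/-- Five-variable form of the Matúš expression, with `P = A` giving the first Matúš family
at `E = C`. The companion case `P = C` is used in the induction. -/
noncomputable def matusExpr {Ω β₁ β₂ β₃ β₄ π ε : Type*} [Fintype Ω] [Fintype β₁] [Fintype β₂]
    [Fintype β₃] [Fintype β₄] [Fintype π] [Fintype ε] (μ : Ω → ℝ) (s : ℝ)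
    (A : Ω → β₁) (B : Ω → β₂) (C : Ω → β₃) (D : Ω → β₄) (P : Ω → π) (E : Ω → ε) : ℝ :=
  s * (ing μ A B C D + cmi μ P B E + cmi μ B E P) + cmi μ P E B
    + s * (s - 1) / 2 * (cmi μ B C A + cmi μ A B C)

section matusExpr

variable {Ω β₁ β₂ β₃ β₄ ε : Type*} [Fintype Ω] [Fintype β₁] [Fintype β₂] [Fintype β₃]
  [Fintype β₄] [Fintype ε] {μ : Ω → ℝ}

theorem matusExpr_le_of_cmi_left (hμ : ∀ ω, 0 ≤ μ ω) {s : ℝ} (hs : 0 ≤ s)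
    (A : Ω → β₁) (B : Ω → β₂) (C : Ω → β₃) (D : Ω → β₄) (E : Ω → ε)
    (hE : cmi μ (fun ω => (C ω, D ω)) E (fun ω => (A ω, B ω)) = 0) :
    matusExpr μ s A B C D C E ≤ matusExpr μ (s + 1) A B C D A E := by
  have h₁ := cmi_nonneg hμ D E A
  have h₂ := cmi_nonneg hμ D E B
  have h₃ := cmi_nonneg hμ D C E
  have h₄ := cmi_nonneg hμ A B (fun ω => (D ω, E ω))
  have h₅ := cmi_nonneg hμ A E (fun ω => (D ω, C ω))
  have h₆ := cmi_nonneg hμ B E (fun ω => (D ω, C ω, A ω))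
  have h₇ := cmi_nonneg hμ C E (fun ω => (D ω, A ω, B ω))
  have h₈ := mul_nonneg (by linarith : 0 ≤ 2 * s + 1) (add_nonneg (add_nonneg
    (cmi_nonneg hμ C E A) (cmi_nonneg hμ A B (fun ω => (C ω, E ω))))
    (cmi_nonneg hμ D E (fun ω => (C ω, A ω, B ω))))
  have h₉ : (2 * s + 3) * cmi μ (fun ω => (C ω, D ω)) E (fun ω => (A ω, B ω)) = 0 := by
    rw [hE, mul_zero]
  simp only [matusExpr, ing, cmi, mi, ent_eq_partitionEnt, ker_prodMk, inf_assoc, inf_comm,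
    inf_left_comm] at *
  linarith

theorem matusExpr_le_of_cmi_right (hμ : ∀ ω, 0 ≤ μ ω) {s : ℝ} (hs : 0 ≤ s)
    (A : Ω → β₁) (B : Ω → β₂) (C : Ω → β₃) (D : Ω → β₄) (E : Ω → ε)
    (hE : cmi μ (fun ω => (A ω, D ω)) E (fun ω => (C ω, B ω)) = 0) :
    matusExpr μ s A B C D A E ≤ matusExpr μ (s + 1) A B C D C E := by
  have h₁ := cmi_nonneg hμ D E A
  have h₂ := cmi_nonneg hμ D E B
  have h₃ := cmi_nonneg hμ D C E
  have h₄ := cmi_nonneg hμ A B (fun ω => (D ω, E ω))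
  have h₅ := cmi_nonneg hμ A E (fun ω => (D ω, C ω))
  have h₆ := cmi_nonneg hμ B E (fun ω => (D ω, C ω, A ω))
  have h₇ := cmi_nonneg hμ C E (fun ω => (D ω, A ω, B ω))
  have h₈ := mul_nonneg (by linarith : 0 ≤ 2 * s + 1) (add_nonneg (add_nonneg
    (cmi_nonneg hμ A E C) (cmi_nonneg hμ C B (fun ω => (A ω, E ω))))
    (cmi_nonneg hμ D E (fun ω => (C ω, A ω, B ω))))
  have h₉ : (2 * s + 3) * cmi μ (fun ω => (A ω, D ω)) E (fun ω => (C ω, B ω)) = 0 := by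
    rw [hE, mul_zero]
  simp only [matusExpr, ing, cmi, mi, ent_eq_partitionEnt, ker_prodMk, inf_assoc, inf_comm,
    inf_left_comm] at *
  linarith

/-- Replacing `E` by its conditionally independent copy over `(P, B)` keeps the expression. -/
theorem matusExpr_condProd {π : Type*} [Fintype π] (hμ : ∀ ω, 0 ≤ μ ω) (s : ℝ)
    (A : Ω → β₁) (B : Ω → β₂) (C : Ω → β₃) (D : Ω → β₄) (P : Ω → π) (E : Ω → ε) :
    matusExpr (condProd μ fun ω => (P ω, B ω)) s (fun p => A p.1) (fun p => B p.1)
      (fun p => C p.1) (fun p => D p.1) (fun p => P p.1) (fun p => E p.2) =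
    matusExpr μ s A B C D P E := by
  set S : Ω → π × β₂ := fun ω => (P ω, B ω) with hS
  have hP : ∀ p : Ω × Ω, S p.1 = S p.2 → P p.1 = P p.2 := fun p hp => congrArg Prod.fst hp
  have hB : ∀ p : Ω × Ω, S p.1 = S p.2 → B p.1 = B p.2 := fun p hp => congrArg Prod.snd hp
  have e₁ : ent (condProd μ S) (fun p => (P p.1, E p.2)) = ent μ (fun ω => (P ω, E ω)) :=
    ent_condProd_snd hμ S _ fun p hp => by rw [hP p hp]
  have e₂ : ent (condProd μ S) (fun p => (B p.1, E p.2)) = ent μ (fun ω => (B ω, E ω)) :=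
    ent_condProd_snd hμ S _ fun p hp => by rw [hB p hp]
  have e₃ : ent (condProd μ S) (fun p => E p.2) = ent μ E :=
    ent_condProd_snd hμ S _ fun p hp => rfl
  have e₄ : ent (condProd μ S) (fun p => (P p.1, B p.1, E p.2)) =
      ent μ (fun ω => (P ω, B ω, E ω)) :=
    ent_condProd_snd hμ S _ fun p hp => by rw [hP p hp, hB p hp]
  have e₅ : ent (condProd μ S) (fun p => (E p.2, P p.1)) = ent μ (fun ω => (E ω, P ω)) :=
    ent_condProd_snd hμ S _ fun p hp => by rw [hP p hp]
  have e₆ : ent (condProd μ S) (fun p => (B p.1, E p.2, P p.1)) =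
      ent μ (fun ω => (B ω, E ω, P ω)) :=
    ent_condProd_snd hμ S _ fun p hp => by rw [hP p hp, hB p hp]
  have e₇ : ent (condProd μ S) (fun p => (E p.2, B p.1)) = ent μ (fun ω => (E ω, B ω)) :=
    ent_condProd_snd hμ S _ fun p hp => by rw [hB p hp]
  have e₈ : ent (condProd μ S) (fun p => (P p.1, E p.2, B p.1)) =
      ent μ (fun ω => (P ω, E ω, B ω)) :=
    ent_condProd_snd hμ S _ fun p hp => by rw [hP p hp, hB p hp]
  have e₉ := ent_condProd_fst hμ S fun ω => (P ω, B ω)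
  have e₁₀ := ent_condProd_fst hμ S fun ω => (B ω, P ω)
  have e₁₁ := ent_condProd_fst hμ S P
  have e₁₂ := ent_condProd_fst hμ S B
  rw [matusExpr, ing_condProd_fst hμ, cmi_condProd_fst hμ S B, cmi_condProd_fst hμ S A]
  simp only [matusExpr, cmi, e₁, e₂, e₃, e₄, e₅, e₆, e₇, e₈, e₉, e₁₀, e₁₁, e₁₂]

end matusExpr

theorem matusExpr_nonneg {β₁ β₂ β₃ β₄ ε : Type*} [Fintype β₁] [Fintype β₂] [Fintype β₃]
    [Fintype β₄] [Fintype ε] (s : ℕ) : ∀ {Ω : Type*} [Fintype Ω] (μ : Ω → ℝ)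
    (_ : ∀ ω, 0 ≤ μ ω) (A : Ω → β₁) (B : Ω → β₂) (C : Ω → β₃) (D : Ω → β₄) (E : Ω → ε),
    0 ≤ matusExpr μ s A B C D A E ∧ 0 ≤ matusExpr μ s A B C D C E := by
  induction s with
  | zero =>
    intro Ω _ μ hμ A B C D E
    simpa [matusExpr] using And.intro (cmi_nonneg hμ A E B) (cmi_nonneg hμ C E B)
  | succ s ih =>
    intro Ω _ μ hμ A B C D E
    push_cast
    constructor
    · rw [← matusExpr_condProd hμ]
      exact (ih _ (condProd_nonneg hμ _) _ _ _ _ _).2.trans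
        (matusExpr_le_of_cmi_left (condProd_nonneg hμ _) s.cast_nonneg _ _ _ _ _
          (cmi_condProd hμ (fun ω => (A ω, B ω)) (fun ω => (C ω, D ω)) E))
    · rw [← matusExpr_condProd hμ]
      exact (ih _ (condProd_nonneg hμ _) _ _ _ _ _).1.trans
        (matusExpr_le_of_cmi_right (condProd_nonneg hμ _) s.cast_nonneg _ _ _ _ _
          (cmi_condProd hμ (fun ω => (C ω, B ω)) (fun ω => (A ω, D ω)) E))

/-- **First Matúš family of non-Shannon inequalities.** For any four random variables
`X1, X2, X3, X4` on a common finite probability space and every integer `s ≥ 1`,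
`s·[I(X1:X2|X3) + I(X1:X2|X4) + I(X3:X4) − I(X1:X2)] + I(X1:X3|X2)
  + (s(s+1)/2)·[I(X2:X3|X1) + I(X1:X2|X3)] ≥ 0`. -/
theorem matus_family_one {Ω β₁ β₂ β₃ β₄ : Type*} [Fintype Ω]
    [Fintype β₁] [Fintype β₂] [Fintype β₃] [Fintype β₄]
    (μ : Ω → ℝ) (hμ0 : ∀ ω, 0 ≤ μ ω) (hμ1 : ∑ ω, μ ω = 1)
    (X1 : Ω → β₁) (X2 : Ω → β₂) (X3 : Ω → β₃) (X4 : Ω → β₄)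
    (s : ℕ) (hs : 1 ≤ s) :
    0 ≤ (s : ℝ) * (cmi μ X1 X2 X3 + cmi μ X1 X2 X4 + mi μ X3 X4 - mi μ X1 X2)
      + cmi μ X1 X3 X2
      + ((s : ℝ) * ((s : ℝ) + 1) / 2) * (cmi μ X2 X3 X1 + cmi μ X1 X2 X3) := by
  have h := (matusExpr_nonneg s μ hμ0 X1 X2 X3 X4 X3).1
  simp only [matusExpr, ing] at h
  linarith
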